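/- arXiv:2412.20624 — 5 statements merged into one kernel-verified Lean document; each statement's English description precedes it below -/
import Mathlib

section
/- Let X be a topological space. Every set belonging to the topology σ (obtained from the local closure function with respect to the ideal of countable sets) is ω-open; that is, σ ⊆ τ_ω. -/
open Set TopologicalSpace

/-- Local closure function w.r.t. the ideal of countable sets:
`Γ(A) = {x : Cl(U) ∩ A is uncountable for every open neighborhood U of x}`. -/
def Gamma (X : Type*) [TopologicalSpace X] (A : Set X) : Set X :=
  {x | ∀ U : Set X, IsOpen U → x ∈ U → ¬ (closure U ∩ A).Countable}

/-- Membership in the topology `σ`: `A ∈ σ ↔ Γ(X \ A) ⊆ X \ A`. -/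
def memSigma (X : Type*) [TopologicalSpace X] (A : Set X) : Prop :=
  Gamma X Aᶜ ⊆ Aᶜ

/-- `A` is ω-open if every point of `A` has an open neighborhood `U`
with `U \ A` countable. -/
def IsOmegaOpen (X : Type*) [TopologicalSpace X] (A : Set X) : Prop :=
  ∀ x ∈ A, ∃ U : Set X, IsOpen U ∧ x ∈ U ∧ (U \ A).Countable

/-- σ ⊆ τ_ω: every set in `σ` is ω-open. -/
theorem sigma_subset_omegaOpen {X : Type*} [TopologicalSpace X] (A : Set X)
    (hA : memSigma X A) : IsOmegaOpen X A := by
  intro x hx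
  by_contra! h
  exact hA (fun U hU hxU hc =>
    h U hU hxU (hc.mono (inter_subset_inter_left _ subset_closure))) hx
end

section
/- Let X = {a} ∪ ℝ, where a ∉ ℝ, with the topology τ generated by the base {{a}} ∪ {{a, r} : r ∈ ℝ}. Then the set {a} is θ_ω-open in X. -/
open Set TopologicalSpace

/-- The ω-closure: closure with respect to the topology of ω-open sets. -/
def ClOmega (X : Type*) [TopologicalSpace X] (A : Set X) : Set X :=
  {x | ∀ V : Set X, IsOmegaOpen X V → x ∈ V → (V ∩ A).Nonempty}

/-- The θω-closure: `Cl_{θω}(A) = {x : Cl_ω(U) ∩ A ≠ ∅ for every open nbhd U of x}`. -/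
def ClThetaOmega (X : Type*) [TopologicalSpace X] (A : Set X) : Set X :=
  {x | ∀ U : Set X, IsOpen U → x ∈ U → (ClOmega X U ∩ A).Nonempty}

/-- `A` is θω-open iff its complement is θω-closed. -/
def IsThetaOmegaOpen (X : Type*) [TopologicalSpace X] (A : Set X) : Prop :=
  ClThetaOmega X Aᶜ = Aᶜ

/-- The space `X = {a} ∪ ℝ` (with `a ∉ ℝ`) modelled as `Option ℝ`, where `a = none`
and each real `r` is `some r`, with the topology generated by the base
`{{a}} ∪ {{a, r} : r ∈ ℝ}`. -/
def tauX : TopologicalSpace (Option ℝ) :=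
  TopologicalSpace.generateFrom
    (insert {none} {s : Set (Option ℝ) | ∃ r : ℝ, s = {none, some r}})

/-- In the space `X = {a} ∪ ℝ` with the base `{{a}} ∪ {{a,r} : r ∈ ℝ}`,
the set `{a}` is θω-open. -/
theorem singleton_a_thetaOmegaOpen :
    @IsThetaOmegaOpen (Option ℝ) tauX {none} := by
  let _ : TopologicalSpace (Option ℝ) := tauX
  change ClThetaOmega (Option ℝ) {none}ᶜ = {none}ᶜ
  refine Subset.antisymm ?_ fun x hx U _ hxU => ⟨x, fun V _ hxV => ⟨x, hxV, hxU⟩, hx⟩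
  rintro x hx rfl
  obtain ⟨y, hy, hya⟩ := hx {none} (isOpen_generateFrom_of_mem (mem_insert _ _)) rfl
  cases y with
  | none => exact hya rfl
  | some r =>
    have hV : IsOmegaOpen (Option ℝ) {some r} := by
      rintro _ rfl
      exact ⟨{none, some r}, isOpen_generateFrom_of_mem (mem_insert_of_mem _ ⟨r, rfl⟩),
        by simp, (Set.toFinite _).countable.mono sdiff_subset⟩
    obtain ⟨z, hz, hza⟩ := hy _ hV rfl
    exact Option.some_ne_none r (hz.symm.trans hza)
end

section
/- Let X = {a} ∪ ℝ, where a ∉ ℝ, with the topology τ generated by the base {{a}} ∪ {{a, r} : r ∈ ℝ}. Then the set {a} does not belong to the topology σ obtained from the local closure function with respect to the ideal of countable sets; indeed, for every open neighborhood U of a, the set Cl(U) ∖ {a} is uncountable. -/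
open Set TopologicalSpace

/-- Every nonempty open set of `tauX` contains the point `a`. -/
lemma none_mem_of_isOpen_tauX {V : Set (Option ℝ)} (hV : @IsOpen (Option ℝ) tauX V)
    (hne : V.Nonempty) : none ∈ V := by
  change GenerateOpen _ V at hV
  induction hV with
  | basic s hs =>
    rcases hs with rfl | ⟨r, rfl⟩ <;> simp
  | univ => trivial
  | inter s t _ _ ihs iht =>
    exact ⟨ihs (hne.mono inter_subset_left), iht (hne.mono inter_subset_right)⟩
  | sUnion S _ ih =>
    obtain ⟨x, s, hs, hx⟩ := hne
    exact ⟨s, hs, ih s hs ⟨x, hx⟩⟩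

/-- The point `a` is dense for `tauX`. -/
lemma closure_tauX_eq_univ {U : Set (Option ℝ)} (hU : none ∈ U) :
    @closure (Option ℝ) tauX U = univ := by
  let := tauX
  refine eq_univ_of_forall fun x => mem_closure_iff.2 fun V hV hx => ?_
  exact ⟨none, none_mem_of_isOpen_tauX hV ⟨x, hx⟩, hU⟩

lemma not_countable_compl_singleton_none : ¬ ({none}ᶜ : Set (Option ℝ)).Countable := by
  intro h
  refine Cardinal.not_countable_real ((h.preimage (Option.some_injective ℝ)).mono ?_)
  intro r _
  simp

/-- In the space `X = {a} ∪ ℝ` with the base `{{a}} ∪ {{a,r} : r ∈ ℝ}`,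
the set `{a}` is not in `σ`; indeed for every open neighborhood `U` of `a`,
the set `Cl(U) \ {a}` is uncountable. -/
theorem singleton_a_not_memSigma :
    ¬ @memSigma (Option ℝ) tauX {none} ∧
      ∀ U : Set (Option ℝ), @IsOpen (Option ℝ) tauX U → none ∈ U →
        ¬ (@closure (Option ℝ) tauX U \ {none}).Countable := by
  have key : ∀ U : Set (Option ℝ), none ∈ U →
      ¬ (@closure (Option ℝ) tauX U ∩ {none}ᶜ).Countable := fun U hU => by
    rw [closure_tauX_eq_univ hU, univ_inter]
    exact not_countable_compl_singleton_none
  refine ⟨fun h => ?_, fun U _ hU => key U hU⟩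
  exact h (a := none) (fun U _ hU => key U hU) rfl
end

section
/- There exists a topological space X in which the topology τ_{θω} of θ_ω-open sets and the topology σ obtained from the local closure function with respect to the ideal of countable sets are incomparable: some θ_ω-open set does not belong to σ, and some set in σ is not θ_ω-open. -/
open Set TopologicalSpace

theorem subset_clOmega (X : Type*) [TopologicalSpace X] (A : Set X) : A ⊆ ClOmega X A :=
  fun x hx _ _ hxV => ⟨x, hxV, hx⟩

/-- Countable sets are ω-closed. -/
theorem clOmega_subset_of_countable (X : Type*) [TopologicalSpace X] {A : Set X}
    (hA : A.Countable) : ClOmega X A ⊆ A := by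
  intro x hx
  by_contra hxA
  obtain ⟨y, hy, hyA⟩ := hx Aᶜ
    (fun z _ => ⟨univ, isOpen_univ, mem_univ z, hA.mono fun w hw => not_not.1 hw.2⟩) hxA
  exact hy hyA

/-- Countable open sets are θω-open. -/
theorem isThetaOmegaOpen_of_countable (X : Type*) [TopologicalSpace X] {A : Set X}
    (hA : A.Countable) (hAo : IsOpen A) : IsThetaOmegaOpen X A := by
  refine Subset.antisymm (fun x hx hxA => ?_)
    (fun x hx U _ hxU => ⟨x, subset_clOmega X U hxU, hx⟩)
  obtain ⟨y, hy, hyA⟩ := hx A hAo hxA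
  exact hyA (clOmega_subset_of_countable X hA hy)

/-- Sets with countable complement belong to `σ`. -/
theorem memSigma_of_countable_compl (X : Type*) [TopologicalSpace X] {A : Set X}
    (hA : Aᶜ.Countable) : memSigma X A :=
  fun x hx => (hx univ isOpen_univ (mem_univ x) (hA.mono inter_subset_right)).elim

/-- θω-open sets are open. -/
theorem IsThetaOmegaOpen.isOpen {X : Type*} [TopologicalSpace X] {A : Set X}
    (hA : IsThetaOmegaOpen X A) : IsOpen A := by
  refine isOpen_iff_forall_mem_open.2 fun x hx => ?_
  by_contra! h
  have hx' : x ∈ ClThetaOmega X Aᶜ := by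
    intro U hU hxU
    obtain ⟨y, hyU, hyA⟩ := not_subset.1 fun hUA => h U hUA hU hxU
    exact ⟨y, subset_clOmega X U hyU, hyA⟩
  rw [IsThetaOmegaOpen] at hA
  rw [hA] at hx'
  exact hx' hx

/-- The topology whose nonempty open sets are the supersets of `S`. -/
abbrev includedSetTopology {X : Type*} (S : Set X) : TopologicalSpace X where
  IsOpen U := U.Nonempty → S ⊆ U
  isOpen_univ _ := subset_univ S
  isOpen_inter _ _ hU hV := fun ⟨x, hxU, hxV⟩ => subset_inter (hU ⟨x, hxU⟩) (hV ⟨x, hxV⟩)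
  isOpen_sUnion _ h := fun ⟨x, U, hU, hxU⟩ => (h U hU ⟨x, hxU⟩).trans (subset_sUnion_of_mem hU)

/-- There is a topological space in which the topology of θω-open sets and the
topology `σ` are incomparable: some θω-open set is not in `σ`,
and some set in `σ` is not θω-open. -/
theorem exists_thetaOmega_sigma_incomparable :
    ∃ (X : Type) (t : TopologicalSpace X),
      (∃ A : Set X, @IsThetaOmegaOpen X t A ∧ ¬ @memSigma X t A) ∧
        (∃ B : Set X, @memSigma X t B ∧ ¬ @IsThetaOmegaOpen X t B) := by
  let S : Set ℝ := {0, 1}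
  have hS : S.Countable := (Set.toFinite S).countable
  let t : TopologicalSpace ℝ := includedSetTopology S
  have h0 : (0 : ℝ) ∈ S := Or.inl rfl
  refine ⟨ℝ, t, ⟨S, @isThetaOmegaOpen_of_countable ℝ t S hS fun _ => Subset.rfl, fun h => ?_⟩,
    ⟨{0}ᶜ, @memSigma_of_countable_compl ℝ t _ ?_, fun h => ?_⟩⟩
  · refine h (a := 0) (fun U hU h0U hc => ?_) h0
    have hcl : @closure ℝ t U = univ := eq_univ_of_forall fun x =>
      (@mem_closure_iff ℝ t x U).2 fun V hV hxV => ⟨0, hV ⟨x, hxV⟩ h0, h0U⟩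
    rw [hcl, univ_inter] at hc
    exact Cardinal.not_countable_real (by simpa using hS.union hc)
  · simp
  · have hsub : S ⊆ {0}ᶜ := @IsThetaOmegaOpen.isOpen ℝ t _ h ⟨1, one_ne_zero⟩
    exact hsub h0 rfl
end

section
/- Let X be a topological space. Every set belonging to the topology σ (obtained from the local closure function with respect to the ideal of countable sets) belongs to the topology τ* obtained from the local function with respect to the ideal of countable sets; that is, σ ⊆ τ*. -/
open Set TopologicalSpace

/-- Local function w.r.t. the ideal of countable sets:
`A* = {x : A ∩ U is uncountable for every open neighborhood U of x}`. -/
def localFun (X : Type*) [TopologicalSpace X] (A : Set X) : Set X :=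
  {x | ∀ U : Set X, IsOpen U → x ∈ U → ¬ (A ∩ U).Countable}

/-- Membership in the topology `τ*`: `A ∈ τ* ↔ Cl*(X \ A) = X \ A`,
where `Cl*(B) = B ∪ B*`. -/
def memTauStar (X : Type*) [TopologicalSpace X] (A : Set X) : Prop :=
  Aᶜ ∪ localFun X Aᶜ = Aᶜ

/-- The local function is contained in the local closure function. -/
theorem localFun_subset_Gamma {X : Type*} [TopologicalSpace X] (A : Set X) :
    localFun X A ⊆ Gamma X A := fun _ hx U hU hxU hc =>
  hx U hU hxU (hc.mono (subset_inter (inter_subset_right.trans subset_closure) inter_subset_left))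

/-- σ ⊆ τ*: every set in `σ` belongs to `τ*`. -/
theorem sigma_subset_tauStar {X : Type*} [TopologicalSpace X] (A : Set X)
    (hA : memSigma X A) : memTauStar X A :=
  union_eq_self_of_subset_right ((localFun_subset_Gamma Aᶜ).trans hA)
end
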